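/- arXiv:1107.2515 — 2 statements merged into one kernel-verified Lean document; each statement's English description precedes it below -/
import Mathlib

section
/- Let k ≥ 1 be an integer and λ > 0, and take absorbing rate α = λ. Then for every t > 0, ψ^el_{k,λ}(t) = 1 − (λ√t/√2)^k · E^{k+1}_{1/2, k/2 + 1}(−λ√t/√2). -/
open Real MeasureTheory Set

/-- Mittag-Leffler function `E_{a,b}(z) = Σ z^r / Γ(a r + b)`. -/
noncomputable def mittagLeffler (a b z : ℝ) : ℝ :=
  ∑' r : ℕ, z ^ r / Real.Gamma (a * r + b)

/-- Wright function `W_{a,b}(x) = Σ x^j / (j! Γ(a j + b))`. -/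
noncomputable def wright (a b x : ℝ) : ℝ :=
  ∑' j : ℕ, x ^ j / ((Nat.factorial j : ℝ) * Real.Gamma (a * j + b))

/-- Generalized Mittag-Leffler function `E^γ_{a,b}(z) = Σ (γ)_j z^j / (j! Γ(a j + b))`. -/
noncomputable def gml (a b γ z : ℝ) : ℝ :=
  ∑' j : ℕ, (∏ i ∈ Finset.range j, (γ + i)) * z ^ j /
    ((Nat.factorial j : ℝ) * Real.Gamma (a * j + b))

/-- Caputo fractional derivative of order `ν`. -/
noncomputable def caputo (ν : ℝ) (f : ℝ → ℝ) (t : ℝ) : ℝ :=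
  (1 / Real.Gamma (1 - ν)) * ∫ s in (0:ℝ)..t, (t - s) ^ (-ν) * deriv f s
/-- Cumulative distribution function of a Gamma random variable with rate `lam`
and integer shape `k`. -/
noncomputable def gammaCdf (lam : ℝ) (k : ℕ) (y : ℝ) : ℝ :=
  (lam ^ k / Real.Gamma k) * ∫ z in (0:ℝ)..y, Real.exp (-lam * z) * z ^ (k - 1)
/-- Crossing probability of a Gamma(`lam`,`k`) boundary by the elastic Brownian
motion with absorbing rate `α`. -/
noncomputable def psiElGamma (k : ℕ) (α lam t : ℝ) : ℝ :=
  2 * (∫ s in Set.Ioi (0:ℝ), (1 - gammaCdf lam k s) * Real.exp (α * s) *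
      ∫ w in Set.Ioi s, w * Real.exp (-α * w) * Real.exp (-(w ^ 2) / (2 * t)) /
        Real.sqrt (2 * Real.pi * t ^ 3)) +
    1 - 2 * Real.exp (α ^ 2 * t / 2) *
      ∫ w in Set.Ioi (α * Real.sqrt t), Real.exp (-(w ^ 2) / 2) / Real.sqrt (2 * Real.pi)

/-- Truncated exponential series with `k` terms. -/
noncomputable def expPartialSum (k : ℕ) (x : ℝ) : ℝ :=
  ∑ r ∈ Finset.range k, x ^ r / (Nat.factorial r : ℝ)

theorem expPartialSum_succ (k : ℕ) (x : ℝ) :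
    expPartialSum (k + 1) x = expPartialSum k x + x ^ k / (Nat.factorial k : ℝ) :=
  Finset.sum_range_succ _ _

theorem expPartialSum_succ_zero (k : ℕ) : expPartialSum (k + 1) 0 = 1 := by
  induction k with
  | zero => simp [expPartialSum]
  | succ k ih => rw [expPartialSum_succ, ih]; simp

theorem hasDerivAt_expPartialSum_succ (k : ℕ) (x : ℝ) :
    HasDerivAt (expPartialSum (k + 1)) (expPartialSum k x) x := by
  induction k with
  | zero =>
    have h : expPartialSum (0 + 1) = fun _ => (1 : ℝ) := by
      funext y; simp [expPartialSum]
    rw [h]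
    simpa [expPartialSum] using hasDerivAt_const x (1 : ℝ)
  | succ k ih =>
    have h : expPartialSum (k + 1 + 1) =
        fun y => expPartialSum (k + 1) y + y ^ (k + 1) / (Nat.factorial (k + 1) : ℝ) := by
      funext y; exact expPartialSum_succ _ _
    rw [h, expPartialSum_succ k x]
    refine (ih.add ((hasDerivAt_pow (k + 1) x).div_const _)).congr_deriv ?_
    rw [Nat.factorial_succ]
    have : (Nat.factorial k : ℝ) ≠ 0 := by positivity
    push_cast
    field_simp

theorem continuous_expPartialSum (k : ℕ) : Continuous (expPartialSum k) := by
  unfold expPartialSum; fun_prop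

theorem hasDerivAt_expPartialSum_mul (k : ℕ) (lam x : ℝ) :
    HasDerivAt (fun s => expPartialSum (k + 1) (lam * s)) (expPartialSum k (lam * x) * lam) x := by
  have h : HasDerivAt (fun s : ℝ => lam * s) lam x := by
    simpa using (hasDerivAt_id x).const_mul lam
  exact (hasDerivAt_expPartialSum_succ k (lam * x)).comp x h

theorem hasDerivAt_exp_mul (c x : ℝ) :
    HasDerivAt (fun s : ℝ => Real.exp (c * s)) (Real.exp (c * x) * c) x := by
  have h : HasDerivAt (fun s : ℝ => c * s) c x := by
    simpa using (hasDerivAt_id x).const_mul c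
  exact h.exp

/-- The survival function of an integer-shape Gamma variable is a Poisson partial sum. -/
theorem one_sub_gammaCdf (m : ℕ) (lam s : ℝ) :
    1 - gammaCdf lam (m + 1) s = Real.exp (-lam * s) * expPartialSum (m + 1) (lam * s) := by
  have hd : ∀ x, HasDerivAt
      (fun s => -(Real.exp (-lam * s) * expPartialSum (m + 1) (lam * s)))
      (lam ^ (m + 1) / (Nat.factorial m : ℝ) * (Real.exp (-lam * x) * x ^ m)) x := by
    intro x
    refine ((hasDerivAt_exp_mul (-lam) x).mul
      (hasDerivAt_expPartialSum_mul m lam x)).neg.congr_deriv ?_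
    rw [expPartialSum_succ]
    ring
  have hint := intervalIntegral.integral_eq_sub_of_hasDerivAt (a := 0) (b := s)
    (fun x _ => hd x) (Continuous.intervalIntegrable (by fun_prop) _ _)
  rw [intervalIntegral.integral_const_mul] at hint
  unfold gammaCdf
  push_cast
  rw [Real.Gamma_nat_eq_factorial, hint]
  simp [expPartialSum_succ_zero]

theorem exp_mul_exp_neg_sq_le {t : ℝ} (ht : 0 < t) (c w : ℝ) :
    Real.exp (c * w) * Real.exp (-(w ^ 2) / (2 * t)) ≤
      Real.exp (c ^ 2 * t) * Real.exp (-(1 / (4 * t)) * w ^ 2) := by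
  rw [← Real.exp_add, ← Real.exp_add, Real.exp_le_exp]
  have h : c ^ 2 * t + -(1 / (4 * t)) * w ^ 2 - (c * w + -(w ^ 2) / (2 * t)) =
      (2 * t * c - w) ^ 2 / (4 * t) := by field_simp; ring
  have : 0 ≤ (2 * t * c - w) ^ 2 / (4 * t) := by positivity
  linarith

theorem integrable_pow_mul_exp_mul_exp_neg_sq {t : ℝ} (ht : 0 < t) (n : ℕ) (c : ℝ) :
    Integrable (fun w : ℝ => w ^ n * (Real.exp (c * w) * Real.exp (-(w ^ 2) / (2 * t)))) := by
  have h := (integrable_rpow_mul_exp_neg_mul_sq (b := 1 / (4 * t)) (by positivity) (s := n)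
    (by have : (0 : ℝ) ≤ n := n.cast_nonneg
        linarith)).norm.const_mul (Real.exp (c ^ 2 * t))
  refine h.mono' (by fun_prop) (Filter.Eventually.of_forall fun w => ?_)
  rw [Real.rpow_natCast, norm_mul (w ^ n), norm_mul (w ^ n),
    Real.norm_of_nonneg (by positivity : 0 ≤ Real.exp (c * w) * Real.exp (-(w ^ 2) / (2 * t))),
    Real.norm_of_nonneg (Real.exp_pos (-(1 / (4 * t)) * w ^ 2)).le]
  calc _ ≤ ‖w ^ n‖ * (Real.exp (c ^ 2 * t) * Real.exp (-(1 / (4 * t)) * w ^ 2)) := by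
        exact mul_le_mul_of_nonneg_left (exp_mul_exp_neg_sq_le ht c w) (norm_nonneg _)
    _ = _ := by ring

theorem integrable_expPartialSum_mul {t : ℝ} (ht : 0 < t) (k : ℕ) (lam c : ℝ) :
    Integrable (fun w : ℝ => expPartialSum k (lam * w) *
      (Real.exp (c * w) * Real.exp (-(w ^ 2) / (2 * t)))) := by
  simp only [expPartialSum, Finset.sum_mul]
  refine integrable_finsetSum _ fun r _ => ?_
  refine ((integrable_pow_mul_exp_mul_exp_neg_sq ht r c).const_mul
    (lam ^ r / (Nat.factorial r : ℝ))).congr (Filter.Eventually.of_forall fun w => ?_)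
  simp only [mul_pow]
  ring

theorem hasDerivAt_exp_neg_sq {t : ℝ} (ht : 0 < t) (x : ℝ) :
    HasDerivAt (fun w : ℝ => Real.exp (-(w ^ 2) / (2 * t)))
      (Real.exp (-(x ^ 2) / (2 * t)) * (-x / t)) x := by
  refine (((hasDerivAt_pow 2 x).neg.div_const (2 * t)).exp).congr_deriv ?_
  have : t ≠ 0 := ht.ne'
  simp only [Pi.neg_apply]
  field_simp
  push_cast
  ring

theorem tendsto_exp_neg_sq {t : ℝ} (ht : 0 < t) :
    Filter.Tendsto (fun w : ℝ => Real.exp (-(w ^ 2) / (2 * t))) Filter.atTop (nhds 0) := by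
  refine Real.tendsto_exp_atBot.comp ?_
  refine Filter.Tendsto.atBot_div_const (by positivity) ?_
  exact Filter.tendsto_neg_atTop_atBot.comp (Filter.tendsto_pow_atTop (by norm_num))

theorem integral_Ioi_mul_exp_neg_sq {t : ℝ} (ht : 0 < t) (s : ℝ) :
    ∫ w in Ioi s, w * Real.exp (-(w ^ 2) / (2 * t)) = t * Real.exp (-(s ^ 2) / (2 * t)) := by
  have h := integral_Ioi_of_hasDerivAt_of_tendsto' (a := s) (m := -t * 0)
    (f := fun w => -t * Real.exp (-(w ^ 2) / (2 * t)))
    (f' := fun w => w * Real.exp (-(w ^ 2) / (2 * t))) (fun x _ => by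
      refine ((hasDerivAt_exp_neg_sq ht x).const_mul (-t)).congr_deriv ?_
      have : t ≠ 0 := ht.ne'
      field_simp) (by
      have := integrable_pow_mul_exp_mul_exp_neg_sq ht 1 0
      simp only [pow_one, zero_mul, Real.exp_zero, one_mul] at this
      exact this.integrableOn) ((tendsto_exp_neg_sq ht).const_mul _)
  rw [h]; ring

/-- Upper tail integral of `w e^{-λw} e^{-w²/(2t)}`. -/
noncomputable def elasticTail (lam t s : ℝ) : ℝ :=
  ∫ w in Ioi s, w * Real.exp (-lam * w) * Real.exp (-(w ^ 2) / (2 * t))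

theorem integrable_mul_exp_mul_exp_neg_sq {t : ℝ} (ht : 0 < t) (lam : ℝ) :
    Integrable (fun w : ℝ => w * Real.exp (-lam * w) * Real.exp (-(w ^ 2) / (2 * t))) := by
  refine (integrable_pow_mul_exp_mul_exp_neg_sq ht 1 (-lam)).congr
    (Filter.Eventually.of_forall fun w => ?_)
  simp only [pow_one, mul_assoc]

theorem elasticTail_nonneg {lam t s : ℝ} (hs : 0 ≤ s) : 0 ≤ elasticTail lam t s := by
  refine setIntegral_nonneg measurableSet_Ioi fun w hw => ?_
  have : 0 < w := lt_of_le_of_lt hs hw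
  positivity

theorem elasticTail_le {lam t s : ℝ} (hlam : 0 ≤ lam) (ht : 0 < t) (hs : 0 ≤ s) :
    elasticTail lam t s ≤ t * (Real.exp (-lam * s) * Real.exp (-(s ^ 2) / (2 * t))) := by
  have h : elasticTail lam t s ≤
      ∫ w in Ioi s, Real.exp (-lam * s) * (w * Real.exp (-(w ^ 2) / (2 * t))) := by
    refine setIntegral_mono_on (integrable_mul_exp_mul_exp_neg_sq ht lam).integrableOn ?_
      measurableSet_Ioi fun w hw => ?_
    · have := integrable_mul_exp_mul_exp_neg_sq ht 0
      simp only [neg_zero, zero_mul, Real.exp_zero, mul_one] at this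
      exact (this.const_mul _).integrableOn
    · have hw' : s < w := hw
      have hw0 : 0 < w := lt_of_le_of_lt hs hw'
      have : Real.exp (-lam * w) ≤ Real.exp (-lam * s) := by
        rw [Real.exp_le_exp]; nlinarith
      calc _ = Real.exp (-lam * w) * (w * Real.exp (-(w ^ 2) / (2 * t))) := by ring
        _ ≤ _ := by gcongr
  rw [integral_const_mul, integral_Ioi_mul_exp_neg_sq ht] at h
  linarith

theorem hasDerivAt_elasticTail {t : ℝ} (ht : 0 < t) (lam s : ℝ) :
    HasDerivAt (elasticTail lam t)
      (-(s * Real.exp (-lam * s) * Real.exp (-(s ^ 2) / (2 * t)))) s := by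
  have hi := integrable_mul_exp_mul_exp_neg_sq ht lam
  have h : elasticTail lam t = fun x => elasticTail lam t 0 -
      ∫ w in (0:ℝ)..x, w * Real.exp (-lam * w) * Real.exp (-(w ^ 2) / (2 * t)) := by
    funext x
    have := intervalIntegral.integral_interval_add_Ioi (a := 0) (b := x)
      hi.integrableOn hi.integrableOn
    simp only [elasticTail]
    linarith
  rw [h]
  have hc : Continuous
      (fun w : ℝ => w * Real.exp (-lam * w) * Real.exp (-(w ^ 2) / (2 * t))) := by fun_prop
  exact ((hc.integral_hasStrictDerivAt 0 s).hasDerivAt).const_sub _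

theorem tendsto_pow_mul_exp_mul_exp_neg_sq {lam t : ℝ} (hlam : 0 < lam) (ht : 0 < t) (n : ℕ) :
    Filter.Tendsto (fun s : ℝ => (lam * s) ^ n *
      (Real.exp (-lam * s) * Real.exp (-(s ^ 2) / (2 * t)))) Filter.atTop (nhds 0) := by
  have h1 := (Real.tendsto_pow_mul_exp_neg_atTop_nhds_zero n).comp
    (Filter.tendsto_id.const_mul_atTop hlam)
  have h2 := h1.mul (tendsto_exp_neg_sq ht)
  rw [zero_mul] at h2
  refine h2.congr fun s => ?_
  simp only [Function.comp_apply, id_eq, neg_mul]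
  ring

theorem tendsto_expPartialSum_mul {lam t : ℝ} (hlam : 0 < lam) (ht : 0 < t) (k : ℕ) :
    Filter.Tendsto (fun s : ℝ => expPartialSum k (lam * s) *
      (Real.exp (-lam * s) * Real.exp (-(s ^ 2) / (2 * t)))) Filter.atTop (nhds 0) := by
  have h := tendsto_finsetSum (Finset.range k) fun r _ =>
    (tendsto_pow_mul_exp_mul_exp_neg_sq hlam ht r).const_mul (1 / (Nat.factorial r : ℝ))
  simp only [mul_zero, Finset.sum_const_zero] at h
  refine h.congr fun s => ?_
  rw [expPartialSum, Finset.sum_mul]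
  exact Finset.sum_congr rfl fun r _ => by ring

theorem expPartialSum_nonneg {x : ℝ} (hx : 0 ≤ x) (k : ℕ) : 0 ≤ expPartialSum k x :=
  Finset.sum_nonneg fun r _ => by positivity

theorem expPartialSum_one_le {x : ℝ} (hx : 0 ≤ x) (k : ℕ) : 1 ≤ expPartialSum (k + 1) x := by
  induction k with
  | zero => simp [expPartialSum]
  | succ k ih =>
    rw [expPartialSum_succ]
    have : 0 ≤ x ^ (k + 1) / (Nat.factorial (k + 1) : ℝ) := by positivity
    linarith

theorem integrableOn_expPartialSum_mul_elasticTail {lam t : ℝ} (hlam : 0 ≤ lam) (ht : 0 < t)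
    (k : ℕ) : IntegrableOn (fun s => expPartialSum k (lam * s) * elasticTail lam t s) (Ioi 0) := by
  have hc : Continuous (elasticTail lam t) :=
    continuous_iff_continuousAt.2 fun s => (hasDerivAt_elasticTail ht lam s).continuousAt
  have hP := continuous_expPartialSum k
  refine ((integrable_expPartialSum_mul ht k lam (-lam)).const_mul t).integrableOn.mono'
    (Continuous.aestronglyMeasurable (by fun_prop)) ?_
  refine (ae_restrict_mem measurableSet_Ioi).mono fun s hs => ?_
  have hs' : 0 ≤ s := (show 0 < s from hs).le
  have h0 := expPartialSum_nonneg (mul_nonneg hlam hs') k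
  rw [Real.norm_of_nonneg (mul_nonneg h0 (elasticTail_nonneg hs'))]
  calc _ ≤ expPartialSum k (lam * s) *
        (t * (Real.exp (-lam * s) * Real.exp (-(s ^ 2) / (2 * t)))) := by
        gcongr; exact elasticTail_le hlam ht hs'
    _ = _ := by ring

theorem integral_expPartialSum_mul_elasticTail {lam t : ℝ} (hlam : 0 < lam) (ht : 0 < t) (k : ℕ) :
    ∫ s in Ioi (0:ℝ), expPartialSum k (lam * s) * elasticTail lam t s =
      t * (∫ s in Ioi (0:ℝ), Real.exp (-lam * s) * Real.exp (-(s ^ 2) / (2 * t))) -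
      t * (lam ^ k / (Nat.factorial k : ℝ)) *
        ∫ s in Ioi (0:ℝ), s ^ k * (Real.exp (-lam * s) * Real.exp (-(s ^ 2) / (2 * t))) := by
  set Q : ℝ → ℝ := fun s => (expPartialSum (k + 1) (lam * s) - 1) / lam with hQ
  have hlam0 : lam ≠ 0 := hlam.ne'
  have ht0 : t ≠ 0 := ht.ne'
  have hQd : ∀ s, HasDerivAt Q (expPartialSum k (lam * s)) s := fun s => by
    refine (((hasDerivAt_expPartialSum_mul k lam s).sub_const 1).div_const lam).congr_deriv ?_
    field_simp
  have hQnn : ∀ s, 0 ≤ s → 0 ≤ Q s := fun s hs =>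
    div_nonneg (sub_nonneg.2 (expPartialSum_one_le (mul_nonneg hlam.le hs) k)) hlam.le
  have i0 := integrable_pow_mul_exp_mul_exp_neg_sq ht 0 (-lam)
  simp only [pow_zero, one_mul] at i0
  have ik := integrable_pow_mul_exp_mul_exp_neg_sq ht k (-lam)
  have iP := integrableOn_expPartialSum_mul_elasticTail hlam.le ht k
  have hD : ∀ s, HasDerivAt
      (fun s => Q s * elasticTail lam t s -
        t * (Q s * (Real.exp (-lam * s) * Real.exp (-(s ^ 2) / (2 * t)))))
      (expPartialSum k (lam * s) * elasticTail lam t s -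
        (t * (Real.exp (-lam * s) * Real.exp (-(s ^ 2) / (2 * t))) -
        t * (lam ^ k / (Nat.factorial k : ℝ)) *
          (s ^ k * (Real.exp (-lam * s) * Real.exp (-(s ^ 2) / (2 * t)))))) s := fun s => by
    refine (((hQd s).mul (hasDerivAt_elasticTail ht lam s)).sub
      (((hQd s).mul ((hasDerivAt_exp_mul (-lam) s).mul
        (hasDerivAt_exp_neg_sq ht s))).const_mul t)).congr_deriv ?_
    simp only [hQ, expPartialSum_succ, Pi.mul_apply]
    field_simp
    ring
  have hQt : Filter.Tendsto (fun s : ℝ => Q s *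
      (Real.exp (-lam * s) * Real.exp (-(s ^ 2) / (2 * t)))) Filter.atTop (nhds 0) := by
    have h := ((tendsto_expPartialSum_mul hlam ht (k + 1)).sub
      (tendsto_pow_mul_exp_mul_exp_neg_sq hlam ht 0)).div_const lam
    rw [sub_zero, zero_div] at h
    refine h.congr fun s => ?_
    simp only [hQ]
    ring
  have hQG : Filter.Tendsto (fun s => Q s * elasticTail lam t s) Filter.atTop (nhds 0) := by
    have h := hQt.const_mul t
    rw [mul_zero] at h
    refine squeeze_zero' ?_ ?_ h
    · filter_upwards [Filter.eventually_ge_atTop 0] with s hs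
      exact mul_nonneg (hQnn s hs) (elasticTail_nonneg hs)
    · filter_upwards [Filter.eventually_ge_atTop 0] with s hs
      calc _ ≤ Q s * (t * (Real.exp (-lam * s) * Real.exp (-(s ^ 2) / (2 * t)))) :=
            mul_le_mul_of_nonneg_left (elasticTail_le hlam.le ht hs) (hQnn s hs)
        _ = _ := by ring
  have iR : IntegrableOn (fun s : ℝ => t * (Real.exp (-lam * s) * Real.exp (-(s ^ 2) / (2 * t))) -
        t * (lam ^ k / (Nat.factorial k : ℝ)) *
          (s ^ k * (Real.exp (-lam * s) * Real.exp (-(s ^ 2) / (2 * t))))) (Ioi 0) :=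
    ((i0.const_mul _).sub (ik.const_mul _)).integrableOn
  have key := integral_Ioi_of_hasDerivAt_of_tendsto' (a := 0) (fun s _ => hD s)
    (iP.sub iR) (hQG.sub (hQt.const_mul t))
  have hQ0 : Q 0 = 0 := by simp [hQ, expPartialSum_succ_zero]
  rw [integral_sub iP iR, integral_sub (i0.const_mul _).integrableOn (ik.const_mul _).integrableOn,
    integral_const_mul, integral_const_mul, hQ0] at key
  linarith

theorem integral_Ioi_exp_neg_sq_shift {t : ℝ} (ht : 0 < t) (lam : ℝ) :
    Real.exp (lam ^ 2 * t / 2) * ∫ w in Ioi (lam * √t), Real.exp (-(w ^ 2) / 2) =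
      (√t)⁻¹ * ∫ w in Ioi (0:ℝ), Real.exp (-lam * w) * Real.exp (-(w ^ 2) / (2 * t)) := by
  have hst : 0 < √t := Real.sqrt_pos.2 ht
  have h1 : ∫ w in Ioi (lam * √t), Real.exp (-(w ^ 2) / 2) =
      ∫ w in Ioi (0:ℝ), Real.exp (-((w + lam * √t) ^ 2) / 2) := by
    have := (measurePreserving_add_right volume (lam * √t)).setIntegral_preimage_emb
      (measurableEmbedding_addRight _) (fun w => Real.exp (-(w ^ 2) / 2)) (Ioi (lam * √t))
    rw [← this]
    simp
  have h2 := integral_comp_mul_left_Ioi (fun w => Real.exp (-((w + lam * √t) ^ 2) / 2)) 0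
    (inv_pos.2 hst)
  rw [mul_zero, inv_inv, smul_eq_mul] at h2
  rw [h1]
  have h3 : ∫ w in Ioi (0:ℝ), Real.exp (-lam * w) * Real.exp (-(w ^ 2) / (2 * t)) =
      Real.exp (lam ^ 2 * t / 2) *
        ∫ w in Ioi (0:ℝ), Real.exp (-(((√t)⁻¹ * w + lam * √t) ^ 2) / 2) := by
    rw [← integral_const_mul]
    congr 1
    funext w
    rw [← Real.exp_add, ← Real.exp_add]
    congr 1
    have hs : √t ^ 2 = t := Real.sq_sqrt ht.le
    have hs' : (√t)⁻¹ ^ 2 = t⁻¹ := by rw [inv_pow, hs]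
    have hm : (√t)⁻¹ * √t = 1 := inv_mul_cancel₀ hst.ne'
    have : ((√t)⁻¹ * w + lam * √t) ^ 2 = t⁻¹ * w ^ 2 + 2 * lam * w + lam ^ 2 * t := by
      linear_combination w ^ 2 * hs' + 2 * w * lam * hm + lam ^ 2 * hs
    rw [this]
    field_simp
    ring
  rw [h3, h2]
  field_simp

theorem integral_pow_mul_exp_neg_sq {t : ℝ} (ht : 0 < t) (n : ℕ) :
    ∫ w in Ioi (0:ℝ), w ^ n * Real.exp (-(w ^ 2) / (2 * t)) =
      √(2 * t) ^ (n + 1) / 2 * Real.Gamma (((n:ℝ) + 1) / 2) := by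
  have hn : (0:ℝ) ≤ n := n.cast_nonneg
  have h := integral_rpow_mul_exp_neg_mul_rpow (p := 2) (q := n) (b := (2 * t)⁻¹) (by norm_num)
    (by linarith) (by positivity)
  have e : ∀ w : ℝ, w ^ n * Real.exp (-(w ^ 2) / (2 * t)) =
      w ^ (n:ℝ) * Real.exp (-(2 * t)⁻¹ * w ^ (2:ℝ)) := fun w => by
    rw [Real.rpow_natCast, Real.rpow_two]
    congr 2
    ring
  simp only [e]
  rw [h, Real.inv_rpow (by positivity), ← Real.rpow_neg (by positivity), Real.sqrt_eq_rpow,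
    ← Real.rpow_natCast, ← Real.rpow_mul (by positivity)]
  have : -(-((n:ℝ) + 1) / 2) = 1 / 2 * ((n + 1 : ℕ) : ℝ) := by push_cast; ring
  rw [this]
  ring

theorem hasSum_integral_pow_mul_exp_mul_exp_neg_sq {t : ℝ} (ht : 0 < t) (k : ℕ) (c : ℝ) :
    HasSum (fun j : ℕ => c ^ j / (Nat.factorial j : ℝ) *
        (√(2 * t) ^ (k + j + 1) / 2 * Real.Gamma ((((k + j : ℕ) : ℝ) + 1) / 2)))
      (∫ w in Ioi (0:ℝ), w ^ k * (Real.exp (c * w) * Real.exp (-(w ^ 2) / (2 * t)))) := by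
  have hexp : ∀ x : ℝ, HasSum (fun n => x ^ n / (Nat.factorial n : ℝ)) (Real.exp x) := fun x => by
    rw [Real.exp_eq_exp_ℝ]; exact NormedSpace.expSeries_div_hasSum_exp x
  have hb : ∀ c w : ℝ, HasSum
      (fun j : ℕ => c ^ j / (Nat.factorial j : ℝ) *
        (w ^ (k + j) * Real.exp (-(w ^ 2) / (2 * t))))
      (w ^ k * (Real.exp (c * w) * Real.exp (-(w ^ 2) / (2 * t)))) := fun c w => by
    have h := ((hexp (c * w)).mul_right (Real.exp (-(w ^ 2) / (2 * t)))).mul_left (w ^ k)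
    have e : ∀ j : ℕ, c ^ j / (Nat.factorial j : ℝ) *
        (w ^ (k + j) * Real.exp (-(w ^ 2) / (2 * t))) =
        w ^ k * ((c * w) ^ j / (Nat.factorial j : ℝ) * Real.exp (-(w ^ 2) / (2 * t))) :=
      fun j => by ring
    simpa only [e] using h
  have h := MeasureTheory.hasSum_integral_of_dominated_convergence (μ := volume.restrict (Ioi 0))
    (F := fun (j : ℕ) (w : ℝ) => c ^ j / (Nat.factorial j : ℝ) *
        (w ^ (k + j) * Real.exp (-(w ^ 2) / (2 * t))))
    (fun (j : ℕ) (w : ℝ) => |c| ^ j / (Nat.factorial j : ℝ) *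
        (w ^ (k + j) * Real.exp (-(w ^ 2) / (2 * t))))
    (fun j => Continuous.aestronglyMeasurable (by fun_prop))
    (fun j => (ae_restrict_mem measurableSet_Ioi).mono fun w hw => by
      have hw' : 0 ≤ w := (show 0 < w from hw).le
      rw [norm_mul, norm_div, norm_pow, Real.norm_eq_abs,
        Real.norm_of_nonneg (by positivity : 0 ≤ w ^ (k + j) * Real.exp (-(w ^ 2) / (2 * t))),
        Real.norm_of_nonneg (by positivity : (0:ℝ) ≤ (Nat.factorial j : ℝ))])
    (Filter.Eventually.of_forall fun w => (hb |c| w).summable)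
    ((integrable_pow_mul_exp_mul_exp_neg_sq ht k |c|).integrableOn.congr
      (Filter.Eventually.of_forall fun w => (hb |c| w).tsum_eq.symm))
    (Filter.Eventually.of_forall fun w => hb c w)
  simpa only [integral_const_mul, integral_pow_mul_exp_neg_sq ht] using h

theorem Gamma_half_nat_succ (n : ℕ) :
    Real.Gamma (((n:ℝ) + 1) / 2) =
      (Nat.factorial n : ℝ) * √Real.pi / (2 ^ n * Real.Gamma ((n:ℝ) / 2 + 1)) := by
  have h := Real.Gamma_mul_Gamma_add_half (((n:ℝ) + 1) / 2)
  have e1 : ((n:ℝ) + 1) / 2 + 1 / 2 = (n:ℝ) / 2 + 1 := by ring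
  have e2 : 2 * (((n:ℝ) + 1) / 2) = (n:ℝ) + 1 := by ring
  have e3 : 1 - ((n:ℝ) + 1) = -(n:ℝ) := by ring
  rw [e1, e2, e3, Real.Gamma_nat_eq_factorial, Real.rpow_neg (by norm_num),
    Real.rpow_natCast] at h
  have hG : Real.Gamma ((n:ℝ) / 2 + 1) ≠ 0 := (Real.Gamma_pos_of_pos (by positivity)).ne'
  rw [eq_div_iff (by positivity)]
  have h2 : (2:ℝ) ^ n * (2 ^ n)⁻¹ = 1 := mul_inv_cancel₀ (by positivity)
  linear_combination 2 ^ n * h + (Nat.factorial n : ℝ) * √Real.pi * h2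

theorem prod_range_succ_add (k j : ℕ) :
    ∏ i ∈ Finset.range j, ((k:ℝ) + 1 + i) =
      (Nat.factorial (k + j) : ℝ) / (Nat.factorial k : ℝ) := by
  rw [eq_div_iff (by positivity), ← Nat.factorial_mul_ascFactorial, Nat.ascFactorial_eq_prod_range]
  push_cast
  ring

/-- The generalized Mittag-Leffler function as a Gaussian-weighted integral. -/
theorem gml_eq_integral {t : ℝ} (ht : 0 < t) (k : ℕ) (lam : ℝ) :
    (lam * √t / √2) ^ k * gml (1/2) ((k:ℝ)/2 + 1) ((k:ℝ) + 1) (-(lam * √t / √2)) =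
      2 / √(2 * Real.pi * t) * (lam ^ k / (Nat.factorial k : ℝ)) *
        ∫ w in Ioi (0:ℝ), w ^ k * (Real.exp (-lam * w) * Real.exp (-(w ^ 2) / (2 * t))) := by
  have h := (hasSum_integral_pow_mul_exp_mul_exp_neg_sq ht k (-lam)).mul_left
    (2 / √(2 * Real.pi * t) * (lam ^ k / (Nat.factorial k : ℝ)))
  rw [← h.tsum_eq, gml, ← tsum_mul_left]
  congr 1
  funext j
  rw [Gamma_half_nat_succ, prod_range_succ_add]
  have e1 : (1:ℝ) / 2 * j + ((k:ℝ) / 2 + 1) = ((k + j : ℕ) : ℝ) / 2 + 1 := by push_cast; ring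
  have e2 : √(2 * Real.pi * t) = √2 * √Real.pi * √t := by
    rw [Real.sqrt_mul (by positivity), Real.sqrt_mul (by positivity)]
  have e3 : √(2 * t) = √2 * √t := Real.sqrt_mul (by positivity) _
  have hG : Real.Gamma (((k + j : ℕ) : ℝ) / 2 + 1) ≠ 0 :=
    (Real.Gamma_pos_of_pos (by positivity)).ne'
  have e4 : lam * √t / √2 = lam * (√2 * √t) / 2 := by
    have : √2 * √2 = 2 := Real.mul_self_sqrt (by norm_num)
    field_simp
    linear_combination -(lam * this)
  have ht' : √t ≠ 0 := (Real.sqrt_pos.2 ht).ne'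
  have hp' : √Real.pi ≠ 0 := (Real.sqrt_pos.2 Real.pi_pos).ne'
  rw [e1, e2, e3, e4]
  generalize Real.Gamma (((k + j : ℕ) : ℝ) / 2 + 1) = g at *
  rw [neg_pow, neg_pow lam]
  simp only [div_pow, mul_pow]
  field_simp
  ring

theorem elastic_gamma_crossing_of_rate_eq (k : ℕ) (hk : 1 ≤ k) (lam : ℝ) (hlam : 0 < lam) :
    ∀ t > (0:ℝ),
      psiElGamma k lam lam t =
        1 - (lam * Real.sqrt t / Real.sqrt 2) ^ k *
          gml (1/2) ((k:ℝ)/2 + 1) ((k:ℝ) + 1) (-(lam * Real.sqrt t / Real.sqrt 2)) := by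
  intro t ht
  obtain ⟨m, rfl⟩ : ∃ m, k = m + 1 := ⟨k - 1, by omega⟩
  rw [gml_eq_integral ht, psiElGamma]
  have h1 : ∀ s : ℝ, (1 - gammaCdf lam (m + 1) s) * Real.exp (lam * s) *
      (∫ w in Set.Ioi s, w * Real.exp (-lam * w) * Real.exp (-(w ^ 2) / (2 * t)) /
        Real.sqrt (2 * Real.pi * t ^ 3)) =
      expPartialSum (m + 1) (lam * s) * elasticTail lam t s / √(2 * Real.pi * t ^ 3) := fun s => by
    rw [integral_div, ← elasticTail, one_sub_gammaCdf]
    have : Real.exp (-lam * s) * Real.exp (lam * s) = 1 := by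
      rw [← Real.exp_add]; simp
    linear_combination (expPartialSum (m + 1) (lam * s) * elasticTail lam t s /
      √(2 * Real.pi * t ^ 3)) * this
  simp only [h1]
  rw [integral_div, integral_div, integral_expPartialSum_mul_elasticTail hlam ht]
  have h2 := integral_Ioi_exp_neg_sq_shift ht lam
  have ht' : √t ≠ 0 := (Real.sqrt_pos.2 ht).ne'
  have e1 : √(2 * Real.pi * t) = √(2 * Real.pi) * √t := Real.sqrt_mul (by positivity) _
  have e2 : √(2 * Real.pi * t ^ 3) = √(2 * Real.pi) * (t * √t) := by
    rw [Real.sqrt_mul (by positivity : 0 ≤ 2 * Real.pi), show t ^ 3 = t ^ 2 * t by ring,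
      Real.sqrt_mul (sq_nonneg t), Real.sqrt_sq ht.le]
  rw [e1, e2]
  have hp : √(2 * Real.pi) ≠ 0 := (Real.sqrt_pos.2 (by positivity)).ne'
  have ht0 : t ≠ 0 := ht.ne'
  rw [mul_assoc 2 (Real.exp (lam ^ 2 * t / 2)), ← mul_div_assoc (Real.exp _), h2]
  field_simp
  ring
end

section
/- Let k ≥ 1 be an integer and α, λ > 0. For every η > 0, the Laplace transform of the Gamma-boundary elastic Brownian crossing probability satisfies ∫_0^∞ e^{−η t} ψ^el_{k,α}(t) dt = 1/η − √2 · λ^k / (√η · (√(2η) + α) · (√(2η) + λ)^k). -/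
open Real MeasureTheory Set

open Filter Topology

/-- Tonelli for a nonnegative integrand, with the inner integral computed on one side. -/
lemma integrable_and_integral_swap_of_nonneg {X Y : Type*} [MeasurableSpace X]
    [MeasurableSpace Y] {μ : Measure X} {ν : Measure Y} [SFinite μ] [SFinite ν]
    {f : X → Y → ℝ} {h : X → ℝ}
    (hm : AEStronglyMeasurable (Function.uncurry f) (μ.prod ν))
    (hpos : ∀ᵐ x ∂μ, ∀ᵐ y ∂ν, 0 ≤ f x y)
    (hint : ∀ᵐ x ∂μ, Integrable (f x) ν)
    (hI : ∀ᵐ x ∂μ, ∫ y, f x y ∂ν = h x) (hh : Integrable h μ) :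
    Integrable (fun y => ∫ x, f x y ∂μ) ν ∧ ∫ y, ∫ x, f x y ∂μ ∂ν = ∫ x, h x ∂μ := by
  have hprod : Integrable (Function.uncurry f) (μ.prod ν) := by
    rw [integrable_prod_iff hm]
    refine ⟨hint, hh.congr ?_⟩
    filter_upwards [hpos, hI] with x hx hxI
    rw [← hxI]
    refine integral_congr_ae ?_
    filter_upwards [hx] with y hy
    simp [Function.uncurry, abs_of_nonneg hy]
  refine ⟨hprod.integral_prod_right, ?_⟩
  rw [← integral_integral_swap hprod]
  exact integral_congr_ae hI

lemma integral_Ioi_of_hasDerivAt_of_nonneg_of_tendsto_nhdsGT {H H' : ℝ → ℝ} {l₀ l : ℝ}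
    (h0 : Tendsto H (𝓝[>] 0) (𝓝 l₀)) (hd : ∀ t ∈ Ioi (0 : ℝ), HasDerivAt H (H' t) t)
    (hpos : ∀ t ∈ Ioi (0 : ℝ), 0 ≤ H' t) (hl : Tendsto H atTop (𝓝 l)) :
    IntegrableOn H' (Ioi 0) ∧ ∫ t in Ioi (0 : ℝ), H' t = l - l₀ := by
  have hc : ContinuousWithinAt (Function.update H 0 l₀) (Ici 0) 0 := by
    rw [continuousWithinAt_update_same]
    simpa using h0
  have hder : ∀ t ∈ Ioi (0 : ℝ), HasDerivAt (Function.update H 0 l₀) (H' t) t := by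
    intro t ht
    refine (hd t ht).congr_of_eventuallyEq ?_
    filter_upwards [Ioi_mem_nhds ht] with s hs
    exact Function.update_of_ne (ne_of_gt hs) _ _
  have hlim : Tendsto (Function.update H 0 l₀) atTop (𝓝 l) := by
    refine hl.congr' ?_
    filter_upwards [Ioi_mem_atTop 0] with s hs
    exact (Function.update_of_ne (ne_of_gt hs) _ _).symm
  refine ⟨integrableOn_Ioi_deriv_of_nonneg hc hder hpos hlim, ?_⟩
  simpa using integral_Ioi_of_hasDerivAt_of_nonneg hc hder hpos hlim

/-- The standard normal cumulative distribution function. -/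
noncomputable def normalCdf (x : ℝ) : ℝ :=
  1 / 2 + (√(2 * π))⁻¹ * ∫ y in (0 : ℝ)..x, exp (-(y ^ 2) / 2)

lemma hasDerivAt_normalCdf (x : ℝ) :
    HasDerivAt normalCdf ((√(2 * π))⁻¹ * exp (-(x ^ 2) / 2)) x := by
  have hc : Continuous fun y : ℝ => exp (-(y ^ 2) / 2) := by fun_prop
  exact ((intervalIntegral.integral_hasDerivAt_right (hc.intervalIntegrable _ _)
    (hc.stronglyMeasurableAtFilter _ _) hc.continuousAt).const_mul _).const_add _

lemma tendsto_normalCdf_atTop : Tendsto normalCdf atTop (𝓝 1) := by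
  have e : (fun y : ℝ => exp (-(y ^ 2) / 2)) = fun y => exp (-(1 / 2) * y ^ 2) := by
    ext y; ring_nf
  have h := intervalIntegral_tendsto_integral_Ioi 0
    ((integrable_exp_neg_mul_sq (b := 1 / 2) (by norm_num)).integrableOn (s := Ioi 0)) tendsto_id
  rw [integral_gaussian_Ioi] at h
  have h2 := (h.const_mul (√(2 * π))⁻¹).const_add (1 / 2)
  have e2 : (1 / 2 : ℝ) + (√(2 * π))⁻¹ * (√(π / (1 / 2)) / 2) = 1 := by
    have : √(2 * π) ≠ 0 := by positivity
    rw [show π / (1 / 2) = 2 * π by ring]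
    field_simp
    norm_num
  rw [e2] at h2
  unfold normalCdf
  rw [e]
  exact h2

lemma normalCdf_neg (x : ℝ) : normalCdf (-x) = 1 - normalCdf x := by
  have h : ∫ y in (0 : ℝ)..-x, exp (-(y ^ 2) / 2) = -∫ y in (0 : ℝ)..x, exp (-(y ^ 2) / 2) := by
    have := intervalIntegral.integral_comp_neg (a := 0) (b := x)
      (fun y : ℝ => exp (-(y ^ 2) / 2))
    simp only [neg_sq, neg_zero] at this
    rw [this, intervalIntegral.integral_symm]
  unfold normalCdf
  rw [h]
  ring

lemma tendsto_normalCdf_atBot : Tendsto normalCdf atBot (𝓝 0) := by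
  have h := (tendsto_normalCdf_atTop.comp tendsto_neg_atBot_atTop).const_sub 1
  simp only [sub_self] at h
  refine h.congr fun x => ?_
  simp [normalCdf_neg]

lemma hasDerivAt_mul_sqrt_sub_div_sqrt (a w : ℝ) {t : ℝ} (ht : 0 < t) :
    HasDerivAt (fun t => a * √t - w / √t) (a / (2 * √t) + w / (2 * t * √t)) t := by
  have hs : 0 < √t := sqrt_pos.2 ht
  have h := hasDerivAt_sqrt ht.ne'
  have h2 := (h.const_mul a).sub ((hasDerivAt_const t w).div h hs.ne')
  refine h2.congr_deriv ?_
  have h3 : √t ^ 2 = t := sq_sqrt ht.le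
  rw [h3]
  field_simp
  ring

lemma tendsto_mul_sqrt_sub_div_sqrt_nhdsGT (a : ℝ) {w : ℝ} (hw : 0 < w) :
    Tendsto (fun t => a * √t - w / √t) (𝓝[>] 0) atBot := by
  have h0 : Tendsto (fun t : ℝ => √t) (𝓝[>] 0) (𝓝 0) := by
    have := (continuous_sqrt.tendsto 0).mono_left (nhdsWithin_le_nhds (s := Ioi 0))
    simpa using this
  have h1 : Tendsto (fun t : ℝ => √t) (𝓝[>] 0) (𝓝[>] 0) := by
    refine tendsto_nhdsWithin_iff.2 ⟨h0, ?_⟩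
    filter_upwards [self_mem_nhdsWithin] with t ht
    exact sqrt_pos.2 ht
  have h2 : Tendsto (fun t : ℝ => w / √t) (𝓝[>] 0) atTop := by
    simpa [div_eq_mul_inv] using (tendsto_inv_nhdsGT_zero.comp h1).const_mul_atTop hw
  have h3 := (h0.const_mul a)
  simp only [sub_eq_add_neg]
  exact h3.add_atBot (tendsto_neg_atTop_atBot.comp h2)

lemma tendsto_mul_sqrt_sub_div_sqrt_atTop {a : ℝ} (ha : 0 < a) (w : ℝ) :
    Tendsto (fun t => a * √t - w / √t) atTop atTop := by
  have h1 : Tendsto (fun t : ℝ => w / √t) atTop (𝓝 0) :=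
    tendsto_sqrt_atTop.const_div_atTop w
  have h2 : Tendsto (fun t : ℝ => a * √t) atTop atTop :=
    tendsto_sqrt_atTop.const_mul_atTop ha
  simp only [sub_eq_add_neg]
  exact h2.atTop_add h1.neg

lemma tendsto_neg_mul_sqrt_sub_div_sqrt_atTop {a : ℝ} (ha : 0 < a) (w : ℝ) :
    Tendsto (fun t => -a * √t - w / √t) atTop atBot := by
  refine (tendsto_neg_atTop_atBot.comp
    (tendsto_mul_sqrt_sub_div_sqrt_atTop ha (-w))).congr fun t => ?_
  simp only [Function.comp]
  ring

lemma exp_mul_exp_neg_sq_mul_sqrt_sub_div_sqrt (a w : ℝ) {t : ℝ} (ht : 0 < t) :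
    exp (-a * w) * exp (-((a * √t - w / √t) ^ 2) / 2) =
      exp (-(a ^ 2 / 2) * t) * exp (-(w ^ 2) / (2 * t)) := by
  rw [← exp_add, ← exp_add]
  congr 1
  have hs : 0 < √t := sqrt_pos.2 ht
  obtain ⟨r, hr⟩ : ∃ r, r = √t := ⟨_, rfl⟩
  have h3 : t = r ^ 2 := by rw [hr, sq_sqrt ht.le]
  rw [← hr] at hs ⊢
  rw [h3]
  field_simp
  ring

lemma sqrt_two_pi_mul_cube {t : ℝ} (ht : 0 < t) :
    √(2 * π * t ^ 3) = √(2 * π) * (t * √t) := by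
  rw [sqrt_mul (by positivity), show t ^ 3 = t ^ 2 * t by ring, sqrt_mul (sq_nonneg t),
    sqrt_sq ht.le]

/-- Laplace transform of the first passage density of Brownian motion at level `w`. -/
lemma laplace_firstPassage {θ w : ℝ} (hθ : 0 < θ) (hw : 0 < w) :
    IntegrableOn (fun t => exp (-(θ ^ 2 / 2) * t) *
      (w * exp (-(w ^ 2) / (2 * t)) / √(2 * π * t ^ 3))) (Ioi 0) ∧
    ∫ t in Ioi (0 : ℝ), exp (-(θ ^ 2 / 2) * t) *
      (w * exp (-(w ^ 2) / (2 * t)) / √(2 * π * t ^ 3)) = exp (-θ * w) := by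
  have key := integral_Ioi_of_hasDerivAt_of_nonneg_of_tendsto_nhdsGT
    (H := fun t => exp (-θ * w) * normalCdf (θ * √t - w / √t) +
      exp (θ * w) * normalCdf (-θ * √t - w / √t))
    (H' := fun t => exp (-(θ ^ 2 / 2) * t) *
      (w * exp (-(w ^ 2) / (2 * t)) / √(2 * π * t ^ 3)))
    (l₀ := exp (-θ * w) * 0 + exp (θ * w) * 0) (l := exp (-θ * w) * 1 + exp (θ * w) * 0)
    (((tendsto_normalCdf_atBot.comp (tendsto_mul_sqrt_sub_div_sqrt_nhdsGT θ hw)).const_mul _).add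
      ((tendsto_normalCdf_atBot.comp
        (tendsto_mul_sqrt_sub_div_sqrt_nhdsGT (-θ) hw)).const_mul _)) ?_ ?_
    (((tendsto_normalCdf_atTop.comp (tendsto_mul_sqrt_sub_div_sqrt_atTop hθ w)).const_mul _).add
      ((tendsto_normalCdf_atBot.comp
        (tendsto_neg_mul_sqrt_sub_div_sqrt_atTop hθ w)).const_mul _))
  · simpa using key
  · intro t ht
    rw [mem_Ioi] at ht
    have h1 := ((hasDerivAt_normalCdf _).comp t
      (hasDerivAt_mul_sqrt_sub_div_sqrt θ w ht)).const_mul (exp (-θ * w))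
    have h2 := ((hasDerivAt_normalCdf _).comp t
      (hasDerivAt_mul_sqrt_sub_div_sqrt (-θ) w ht)).const_mul (exp (θ * w))
    refine (h1.add h2).congr_deriv ?_
    have e1 := exp_mul_exp_neg_sq_mul_sqrt_sub_div_sqrt θ w ht
    have e2 := exp_mul_exp_neg_sq_mul_sqrt_sub_div_sqrt (-θ) w ht
    rw [neg_neg, neg_sq] at e2
    have hs : 0 < √t := sqrt_pos.2 ht
    have hp : √(2 * π) ≠ 0 := by positivity
    rw [sqrt_two_pi_mul_cube ht]
    calc _ = (√(2 * π))⁻¹ * ((exp (-θ * w) * exp (-((θ * √t - w / √t) ^ 2) / 2)) *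
            (θ / (2 * √t) + w / (2 * t * √t)) +
          (exp (θ * w) * exp (-((-θ * √t - w / √t) ^ 2) / 2)) *
            (-θ / (2 * √t) + w / (2 * t * √t))) := by ring
      _ = _ := by
        rw [e1, e2]
        field_simp
        ring
  · intro t ht
    positivity

/-- Laplace transform of the Brownian transition density at distance `w`. -/
lemma laplace_heatKernel {θ w : ℝ} (hθ : 0 < θ) (hw : 0 < w) :
    IntegrableOn (fun t => exp (-(θ ^ 2 / 2) * t) *
      (exp (-(w ^ 2) / (2 * t)) / (√(2 * π) * √t))) (Ioi 0) ∧
    ∫ t in Ioi (0 : ℝ), exp (-(θ ^ 2 / 2) * t) *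
      (exp (-(w ^ 2) / (2 * t)) / (√(2 * π) * √t)) = exp (-θ * w) / θ := by
  have key := integral_Ioi_of_hasDerivAt_of_nonneg_of_tendsto_nhdsGT
    (H := fun t => exp (-θ * w) / θ * normalCdf (θ * √t - w / √t) -
      exp (θ * w) / θ * normalCdf (-θ * √t - w / √t))
    (H' := fun t => exp (-(θ ^ 2 / 2) * t) *
      (exp (-(w ^ 2) / (2 * t)) / (√(2 * π) * √t)))
    (l₀ := exp (-θ * w) / θ * 0 - exp (θ * w) / θ * 0)
    (l := exp (-θ * w) / θ * 1 - exp (θ * w) / θ * 0)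
    (((tendsto_normalCdf_atBot.comp (tendsto_mul_sqrt_sub_div_sqrt_nhdsGT θ hw)).const_mul _).sub
      ((tendsto_normalCdf_atBot.comp
        (tendsto_mul_sqrt_sub_div_sqrt_nhdsGT (-θ) hw)).const_mul _)) ?_ ?_
    (((tendsto_normalCdf_atTop.comp (tendsto_mul_sqrt_sub_div_sqrt_atTop hθ w)).const_mul _).sub
      ((tendsto_normalCdf_atBot.comp
        (tendsto_neg_mul_sqrt_sub_div_sqrt_atTop hθ w)).const_mul _))
  · simpa using key
  · intro t ht
    rw [mem_Ioi] at ht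
    have h1 := ((hasDerivAt_normalCdf _).comp t
      (hasDerivAt_mul_sqrt_sub_div_sqrt θ w ht)).const_mul (exp (-θ * w) / θ)
    have h2 := ((hasDerivAt_normalCdf _).comp t
      (hasDerivAt_mul_sqrt_sub_div_sqrt (-θ) w ht)).const_mul (exp (θ * w) / θ)
    refine (h1.sub h2).congr_deriv ?_
    have e1 := exp_mul_exp_neg_sq_mul_sqrt_sub_div_sqrt θ w ht
    have e2 := exp_mul_exp_neg_sq_mul_sqrt_sub_div_sqrt (-θ) w ht
    rw [neg_neg, neg_sq] at e2
    have hs : 0 < √t := sqrt_pos.2 ht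
    have hp : √(2 * π) ≠ 0 := by positivity
    calc _ = (√(2 * π))⁻¹ / θ * ((exp (-θ * w) * exp (-((θ * √t - w / √t) ^ 2) / 2)) *
            (θ / (2 * √t) + w / (2 * t * √t)) -
          (exp (θ * w) * exp (-((-θ * √t - w / √t) ^ 2) / 2)) *
            (-θ / (2 * √t) + w / (2 * t * √t))) := by ring
      _ = _ := by
        rw [e1, e2]
        field_simp
        ring
  · intro t ht
    positivity

lemma integrableOn_exp_neg_mul_Ioi {a : ℝ} (ha : 0 < a) (c : ℝ) :
    IntegrableOn (fun x => exp (-a * x)) (Ioi c) :=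
  integrableOn_exp_mul_Ioi (neg_neg_of_pos ha) c

lemma integral_exp_neg_mul_Ioi {a : ℝ} (ha : 0 < a) (c : ℝ) :
    ∫ x in Ioi c, exp (-a * x) = exp (-a * c) / a := by
  rw [integral_exp_mul_Ioi (neg_neg_of_pos ha) c, neg_div_neg_eq]

/-- Density of a Gamma random variable with rate `lam` and integer shape `k`. -/
noncomputable def gammaDensity (lam : ℝ) (k : ℕ) (z : ℝ) : ℝ :=
  lam ^ k / Gamma k * (exp (-lam * z) * z ^ (k - 1))

lemma continuous_gammaDensity (lam : ℝ) (k : ℕ) : Continuous (gammaDensity lam k) := by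
  unfold gammaDensity; fun_prop

lemma gammaDensity_nonneg {lam : ℝ} (hlam : 0 < lam) (k : ℕ) {z : ℝ} (hz : 0 ≤ z) :
    0 ≤ gammaDensity lam k z := by
  have : 0 ≤ Gamma (k : ℝ) := Gamma_nonneg_of_nonneg (Nat.cast_nonneg k)
  unfold gammaDensity; positivity

lemma laplace_gammaDensity {k : ℕ} (hk : 1 ≤ k) {lam θ : ℝ} (hlam : 0 < lam) (hθ : 0 ≤ θ) :
    IntegrableOn (fun z => gammaDensity lam k z * exp (-θ * z)) (Ioi 0) ∧
    ∫ z in Ioi (0 : ℝ), gammaDensity lam k z * exp (-θ * z) = (lam / (lam + θ)) ^ k := by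
  have hk0 : (0 : ℝ) < k := by exact_mod_cast hk
  have hG : Gamma (k : ℝ) ≠ 0 := (Gamma_pos_of_pos hk0).ne'
  have hr : 0 < lam + θ := by positivity
  have e : ∀ z ∈ Ioi (0 : ℝ), lam ^ k / Gamma k * (z ^ ((k : ℝ) - 1) * exp (-((lam + θ) * z))) =
      gammaDensity lam k z * exp (-θ * z) := by
    intro z hz
    unfold gammaDensity
    rw [show (k : ℝ) - 1 = ((k - 1 : ℕ) : ℝ) by push_cast [hk]; ring, rpow_natCast,
      show -((lam + θ) * z) = -lam * z + -θ * z by ring, exp_add]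
    ring
  have hI := integral_rpow_mul_exp_neg_mul_Ioi hk0 hr
  have hval : ∫ z in Ioi (0 : ℝ), gammaDensity lam k z * exp (-θ * z) =
      (lam / (lam + θ)) ^ k := by
    rw [← setIntegral_congr_fun measurableSet_Ioi e, integral_const_mul, hI, rpow_natCast]
    rw [div_pow, div_pow, one_pow]
    field_simp
  refine ⟨?_, hval⟩
  by_contra hn
  have h0 := integral_undef hn
  rw [hval] at h0
  have : 0 < (lam / (lam + θ)) ^ k := by positivity
  exact this.ne' h0

lemma gammaCdf_eq (lam : ℝ) (k : ℕ) (s : ℝ) :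
    gammaCdf lam k s = ∫ z in (0 : ℝ)..s, gammaDensity lam k z := by
  unfold gammaCdf gammaDensity
  rw [intervalIntegral.integral_const_mul]

lemma continuous_gammaCdf (lam : ℝ) (k : ℕ) : Continuous (gammaCdf lam k) := by
  rw [funext (gammaCdf_eq lam k)]
  exact intervalIntegral.continuous_primitive
    (fun a b => (continuous_gammaDensity lam k).intervalIntegrable a b) 0

lemma one_sub_gammaCdf_s17 {k : ℕ} (hk : 1 ≤ k) {lam : ℝ} (hlam : 0 < lam) {s : ℝ} (hs : 0 ≤ s) :
    1 - gammaCdf lam k s = ∫ z in Ioi s, gammaDensity lam k z := by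
  have h := laplace_gammaDensity hk hlam le_rfl
  simp only [neg_zero, zero_mul, exp_zero, mul_one, add_zero, div_self hlam.ne', one_pow] at h
  have h2 := intervalIntegral.integral_interval_add_Ioi h.1 (h.1.mono_set (Ioi_subset_Ioi hs))
  rw [gammaCdf_eq]
  linarith [h.2]

lemma gammaCdf_le_one {k : ℕ} (hk : 1 ≤ k) {lam : ℝ} (hlam : 0 < lam) {s : ℝ} (hs : 0 ≤ s) :
    gammaCdf lam k s ≤ 1 := by
  rw [← sub_nonneg, one_sub_gammaCdf_s17 hk hlam hs]
  exact setIntegral_nonneg measurableSet_Ioi fun z hz =>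
    gammaDensity_nonneg hlam k (hs.trans (le_of_lt hz))

/-- Laplace transform of the Gamma survival function. -/
lemma laplace_one_sub_gammaCdf {k : ℕ} (hk : 1 ≤ k) {lam θ : ℝ} (hlam : 0 < lam) (hθ : 0 < θ) :
    IntegrableOn (fun s => (1 - gammaCdf lam k s) * exp (-θ * s)) (Ioi 0) ∧
    ∫ s in Ioi (0 : ℝ), (1 - gammaCdf lam k s) * exp (-θ * s) =
      (1 - (lam / (lam + θ)) ^ k) / θ := by
  obtain ⟨hLi, hLv⟩ := laplace_gammaDensity hk hlam hθ.le
  have hpt : ∀ s ∈ Ioi (0 : ℝ), ∫ z in Ioi (0 : ℝ),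
      (Ioi z).indicator (fun s => gammaDensity lam k z * exp (-θ * s)) s =
        gammaCdf lam k s * exp (-θ * s) := by
    intro s hs
    have : ∀ z, (Ioi z).indicator (fun s => gammaDensity lam k z * exp (-θ * s)) s =
        (Iio s).indicator (fun z => gammaDensity lam k z * exp (-θ * s)) z := fun z => by
      simp [indicator_apply]
    simp_rw [this]
    rw [setIntegral_indicator measurableSet_Iio, Ioi_inter_Iio, integral_mul_const,
      ← integral_Ioc_eq_integral_Ioo, gammaCdf_eq, intervalIntegral.integral_of_le (le_of_lt hs)]
  have hexp : ∀ z ∈ Ioi (0 : ℝ), (∫ s in Ioi (0 : ℝ),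
      (Ioi z).indicator (fun s => gammaDensity lam k z * exp (-θ * s)) s) =
        gammaDensity lam k z * exp (-θ * z) / θ := by
    intro z hz
    rw [setIntegral_indicator measurableSet_Ioi, Ioi_inter_Ioi, sup_eq_right.2 (le_of_lt hz),
      integral_const_mul, integral_exp_neg_mul_Ioi hθ, mul_div_assoc]
  have key := integrable_and_integral_swap_of_nonneg
    (μ := volume.restrict (Ioi (0 : ℝ))) (ν := volume.restrict (Ioi (0 : ℝ)))
    (f := fun z s => (Ioi z).indicator (fun s => gammaDensity lam k z * exp (-θ * s)) s)
    (h := fun z => gammaDensity lam k z * exp (-θ * z) / θ)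
    (by
      refine Measurable.aestronglyMeasurable ?_
      refine Measurable.ite (measurableSet_lt measurable_fst measurable_snd) ?_ measurable_const
      exact (((continuous_gammaDensity lam k).comp continuous_fst).mul
        (by fun_prop : Continuous fun p : ℝ × ℝ => exp (-θ * p.2))).measurable)
    (by
      filter_upwards [ae_restrict_mem measurableSet_Ioi] with z hz
      filter_upwards with s
      exact indicator_nonneg (fun _ _ => mul_nonneg (gammaDensity_nonneg hlam k (le_of_lt hz))
        (exp_pos _).le) _)
    (by
      filter_upwards with z
      exact ((integrableOn_exp_neg_mul_Ioi hθ 0).const_mul _).indicator measurableSet_Ioi)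
    (by
      filter_upwards [ae_restrict_mem measurableSet_Ioi] with z hz using hexp z hz)
    (hLi.div_const θ)
  have hF : IntegrableOn (fun s => gammaCdf lam k s * exp (-θ * s)) (Ioi 0) :=
    (integrableOn_congr_fun hpt measurableSet_Ioi).1 key.1
  have hFv := key.2
  rw [setIntegral_congr_fun measurableSet_Ioi hpt, integral_div, hLv] at hFv
  have h1 := integrableOn_exp_neg_mul_Ioi hθ 0
  simp only [sub_mul, one_mul]
  refine ⟨h1.sub hF, ?_⟩
  rw [integral_sub h1 hF, hFv, integral_exp_neg_mul_Ioi hθ]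
  simp [sub_div]

lemma elastic_kernel_laplace {α θ s : ℝ} (hα : 0 < α) (hθ : 0 < θ) (hs : 0 ≤ s) :
    IntegrableOn (fun t => ∫ w in Ioi s, exp (-(θ ^ 2 / 2) * t) *
      (w * exp (-α * w) * exp (-(w ^ 2) / (2 * t)) / √(2 * π * t ^ 3))) (Ioi 0) ∧
    ∫ t in Ioi (0 : ℝ), ∫ w in Ioi s, exp (-(θ ^ 2 / 2) * t) *
      (w * exp (-α * w) * exp (-(w ^ 2) / (2 * t)) / √(2 * π * t ^ 3)) =
        exp (-(α + θ) * s) / (α + θ) := by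
  have e : ∀ w t : ℝ, exp (-(θ ^ 2 / 2) * t) *
      (w * exp (-α * w) * exp (-(w ^ 2) / (2 * t)) / √(2 * π * t ^ 3)) =
      exp (-α * w) * (exp (-(θ ^ 2 / 2) * t) *
      (w * exp (-(w ^ 2) / (2 * t)) / √(2 * π * t ^ 3))) := fun w t => by ring
  have hpos : 0 < α + θ := by positivity
  rw [← integral_exp_neg_mul_Ioi hpos]
  refine integrable_and_integral_swap_of_nonneg (μ := volume.restrict (Ioi s))
    (ν := volume.restrict (Ioi (0 : ℝ)))
    (f := fun w t => exp (-(θ ^ 2 / 2) * t) *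
      (w * exp (-α * w) * exp (-(w ^ 2) / (2 * t)) / √(2 * π * t ^ 3)))
    (h := fun w => exp (-(α + θ) * w)) ?_ ?_ ?_ ?_ (integrableOn_exp_neg_mul_Ioi hpos s)
  · refine Measurable.aestronglyMeasurable ?_
    unfold Function.uncurry
    fun_prop
  · filter_upwards [ae_restrict_mem measurableSet_Ioi] with w hw
    filter_upwards with t
    have : 0 < w := lt_of_le_of_lt hs hw
    positivity
  · filter_upwards [ae_restrict_mem measurableSet_Ioi] with w hw
    simp only [e]
    exact (laplace_firstPassage hθ (lt_of_le_of_lt hs hw)).1.const_mul _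
  · filter_upwards [ae_restrict_mem measurableSet_Ioi] with w hw
    simp only [e]
    rw [integral_const_mul, (laplace_firstPassage hθ (lt_of_le_of_lt hs hw)).2, ← exp_add]
    ring_nf

lemma elastic_gamma_term_laplace {k : ℕ} (hk : 1 ≤ k) {α lam θ : ℝ} (hα : 0 < α)
    (hlam : 0 < lam) (hθ : 0 < θ) :
    IntegrableOn (fun t => exp (-(θ ^ 2 / 2) * t) *
      ∫ s in Ioi (0 : ℝ), (1 - gammaCdf lam k s) * exp (α * s) *
      ∫ w in Ioi s, w * exp (-α * w) * exp (-(w ^ 2) / (2 * t)) / √(2 * π * t ^ 3)) (Ioi 0) ∧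
    ∫ t in Ioi (0 : ℝ), exp (-(θ ^ 2 / 2) * t) *
      ∫ s in Ioi (0 : ℝ), (1 - gammaCdf lam k s) * exp (α * s) *
      ∫ w in Ioi s, w * exp (-α * w) * exp (-(w ^ 2) / (2 * t)) / √(2 * π * t ^ 3) =
        (1 - (lam / (lam + θ)) ^ k) / θ / (α + θ) := by
  have hpos : 0 < α + θ := by positivity
  obtain ⟨hSi, hSv⟩ := laplace_one_sub_gammaCdf hk hlam hθ
  rw [← hSv, ← integral_div]
  have e : ∀ t, exp (-(θ ^ 2 / 2) * t) *
      (∫ s in Ioi (0 : ℝ), (1 - gammaCdf lam k s) * exp (α * s) *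
      ∫ w in Ioi s, w * exp (-α * w) * exp (-(w ^ 2) / (2 * t)) / √(2 * π * t ^ 3)) =
      ∫ s in Ioi (0 : ℝ), (1 - gammaCdf lam k s) * exp (α * s) *
        ∫ w in Ioi s, exp (-(θ ^ 2 / 2) * t) *
          (w * exp (-α * w) * exp (-(w ^ 2) / (2 * t)) / √(2 * π * t ^ 3)) := by
    intro t
    rw [← integral_const_mul]
    congr 1
    ext s
    rw [integral_const_mul]
    ring
  simp only [e]
  refine integrable_and_integral_swap_of_nonneg (μ := volume.restrict (Ioi (0 : ℝ)))
    (ν := volume.restrict (Ioi (0 : ℝ)))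
    (f := fun s t => (1 - gammaCdf lam k s) * exp (α * s) *
        ∫ w in Ioi s, exp (-(θ ^ 2 / 2) * t) *
          (w * exp (-α * w) * exp (-(w ^ 2) / (2 * t)) / √(2 * π * t ^ 3)))
    (h := fun s => (1 - gammaCdf lam k s) * exp (-θ * s) / (α + θ)) ?_ ?_ ?_ ?_
    (hSi.div_const _)
  · have hm : Measurable fun q : (ℝ × ℝ) × ℝ => (Ioi q.1.1).indicator (fun w =>
        exp (-(θ ^ 2 / 2) * q.1.2) *
          (w * exp (-α * w) * exp (-(w ^ 2) / (2 * q.1.2)) / √(2 * π * q.1.2 ^ 3))) q.2 := by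
      refine Measurable.ite
        (measurableSet_lt (measurable_fst.comp measurable_fst) measurable_snd) ?_ measurable_const
      fun_prop
    have hm2 := hm.stronglyMeasurable.integral_prod_right' (ν := (volume : Measure ℝ))
    simp only [integral_indicator measurableSet_Ioi] at hm2
    have hc : Continuous fun p : ℝ × ℝ => (1 - gammaCdf lam k p.1) * exp (α * p.1) := by
      have := continuous_gammaCdf lam k
      fun_prop
    exact (hc.stronglyMeasurable.mul hm2).aestronglyMeasurable
  · filter_upwards [ae_restrict_mem measurableSet_Ioi] with s hs
    filter_upwards with t
    rw [mem_Ioi] at hs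
    have h1 : 0 ≤ 1 - gammaCdf lam k s := sub_nonneg.2 (gammaCdf_le_one hk hlam hs.le)
    refine mul_nonneg (by positivity) (setIntegral_nonneg measurableSet_Ioi fun w hw => ?_)
    have : 0 < w := hs.trans hw
    positivity
  · filter_upwards [ae_restrict_mem measurableSet_Ioi] with s hs
    exact (elastic_kernel_laplace hα hθ (le_of_lt hs)).1.const_mul _
  · filter_upwards [ae_restrict_mem measurableSet_Ioi] with s hs
    rw [integral_const_mul, (elastic_kernel_laplace hα hθ (le_of_lt hs)).2,
      show -(α + θ) * s = -(α * s) + -θ * s by ring, exp_add, exp_neg]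
    field_simp

/-- The survival probability of elastic Brownian motion, as the expectation of `exp (-α |B_t|)`. -/
lemma elastic_survival_eq (α : ℝ) {t : ℝ} (ht : 0 < t) :
    exp (α ^ 2 * t / 2) * ∫ w in Ioi (α * √t), exp (-(w ^ 2) / 2) / √(2 * π) =
      ∫ x in Ioi (0 : ℝ), exp (-α * x) * (exp (-(x ^ 2) / (2 * t)) / (√(2 * π) * √t)) := by
  have hs : 0 < √t := sqrt_pos.2 ht
  have h1 := integral_comp_mul_left_Ioi (fun w : ℝ => exp (-((w + α * √t) ^ 2) / 2) / √(2 * π))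
    0 (inv_pos.2 hs)
  have h2 : ∫ x in Ioi (0 : ℝ), exp (-((x + α * √t) ^ 2) / 2) / √(2 * π) =
      ∫ w in Ioi (α * √t), exp (-(w ^ 2) / 2) / √(2 * π) := by
    have := (measurePreserving_add_right (volume : Measure ℝ) (α * √t)).setIntegral_preimage_emb
      (measurableEmbedding_addRight _) (fun w => exp (-(w ^ 2) / 2) / √(2 * π)) (Ioi (α * √t))
    rw [← this]
    simp
  rw [mul_zero, inv_inv, smul_eq_mul, h2] at h1
  have h3 : ∫ w in Ioi (α * √t), exp (-(w ^ 2) / 2) / √(2 * π) = (√t)⁻¹ *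
      ∫ x in Ioi (0 : ℝ), exp (-(((√t)⁻¹ * x + α * √t) ^ 2) / 2) / √(2 * π) := by
    rw [h1]; field_simp
  rw [h3, ← integral_const_mul, ← integral_const_mul]
  congr 1
  ext x
  have h4 : exp (-α * x) * exp (-(x ^ 2) / (2 * t)) =
      exp (α ^ 2 * t / 2) * exp (-(((√t)⁻¹ * x + α * √t) ^ 2) / 2) := by
    rw [← exp_add, ← exp_add]
    congr 1
    obtain ⟨r, hr⟩ : ∃ r, r = √t := ⟨_, rfl⟩
    have h5 : t = r ^ 2 := by rw [hr, sq_sqrt ht.le]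
    rw [← hr] at hs ⊢
    rw [h5]
    field_simp
    ring
  calc _ = exp (α ^ 2 * t / 2) * exp (-(((√t)⁻¹ * x + α * √t) ^ 2) / 2) / (√(2 * π) * √t) := by
        field_simp
    _ = _ := by rw [← h4, mul_div_assoc]

lemma elastic_survival_laplace {α θ : ℝ} (hα : 0 < α) (hθ : 0 < θ) :
    IntegrableOn (fun t => exp (-(θ ^ 2 / 2) * t) * (exp (α ^ 2 * t / 2) *
      ∫ w in Ioi (α * √t), exp (-(w ^ 2) / 2) / √(2 * π))) (Ioi 0) ∧
    ∫ t in Ioi (0 : ℝ), exp (-(θ ^ 2 / 2) * t) * (exp (α ^ 2 * t / 2) *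
      ∫ w in Ioi (α * √t), exp (-(w ^ 2) / 2) / √(2 * π)) = 1 / (α + θ) / θ := by
  have hpos : 0 < α + θ := by positivity
  have e : ∀ t ∈ Ioi (0 : ℝ), exp (-(θ ^ 2 / 2) * t) * (exp (α ^ 2 * t / 2) *
      ∫ w in Ioi (α * √t), exp (-(w ^ 2) / 2) / √(2 * π)) =
      ∫ x in Ioi (0 : ℝ), exp (-α * x) * (exp (-(θ ^ 2 / 2) * t) *
        (exp (-(x ^ 2) / (2 * t)) / (√(2 * π) * √t))) := by
    intro t ht
    rw [elastic_survival_eq α ht, ← integral_const_mul]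
    congr 1
    ext x
    ring
  have hv : ∫ x in Ioi (0 : ℝ), exp (-(α + θ) * x) / θ = 1 / (α + θ) / θ := by
    rw [integral_div, integral_exp_neg_mul_Ioi hpos]
    simp
  rw [integrableOn_congr_fun e measurableSet_Ioi, setIntegral_congr_fun measurableSet_Ioi e, ← hv]
  refine integrable_and_integral_swap_of_nonneg (μ := volume.restrict (Ioi (0 : ℝ)))
    (ν := volume.restrict (Ioi (0 : ℝ)))
    (f := fun x t => exp (-α * x) * (exp (-(θ ^ 2 / 2) * t) *
        (exp (-(x ^ 2) / (2 * t)) / (√(2 * π) * √t))))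
    (h := fun x => exp (-(α + θ) * x) / θ) ?_ ?_ ?_ ?_
    ((integrableOn_exp_neg_mul_Ioi hpos 0).div_const _)
  · refine Measurable.aestronglyMeasurable ?_
    unfold Function.uncurry
    fun_prop
  · filter_upwards with x
    filter_upwards with t
    positivity
  · filter_upwards [ae_restrict_mem measurableSet_Ioi] with x hx
    exact (laplace_heatKernel hθ hx).1.const_mul _
  · filter_upwards [ae_restrict_mem measurableSet_Ioi] with x hx
    rw [integral_const_mul, (laplace_heatKernel hθ hx).2, ← mul_div_assoc, ← exp_add]
    ring_nf

theorem elastic_gamma_crossing_laplace (k : ℕ) (hk : 1 ≤ k) (α lam : ℝ)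
    (hα : 0 < α) (hlam : 0 < lam) :
    ∀ η > (0:ℝ),
      (∫ t in Set.Ioi (0:ℝ), Real.exp (-η * t) * psiElGamma k α lam t) =
        1 / η - Real.sqrt 2 * lam ^ k /
          (Real.sqrt η * (Real.sqrt (2 * η) + α) * (Real.sqrt (2 * η) + lam) ^ k) := by
  intro η hη
  obtain ⟨θ, hθe⟩ : ∃ θ, θ = √(2 * η) := ⟨_, rfl⟩
  have hθ : 0 < θ := by rw [hθe]; positivity
  have hηθ : η = θ ^ 2 / 2 := by rw [hθe, sq_sqrt (by positivity)]; ring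
  obtain ⟨h1, h1v⟩ := elastic_gamma_term_laplace hk hα hlam hθ
  obtain ⟨h2, h2v⟩ := elastic_survival_laplace hα hθ
  rw [← hηθ] at h1 h1v h2 h2v
  have h0 := integrableOn_exp_neg_mul_Ioi hη 0
  have h0v := integral_exp_neg_mul_Ioi hη 0
  have e : ∀ t, exp (-η * t) * psiElGamma k α lam t =
      2 * (exp (-η * t) * ∫ s in Ioi (0 : ℝ), (1 - gammaCdf lam k s) * exp (α * s) *
        ∫ w in Ioi s, w * exp (-α * w) * exp (-(w ^ 2) / (2 * t)) / √(2 * π * t ^ 3)) +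
      exp (-η * t) - 2 * (exp (-η * t) * (exp (α ^ 2 * t / 2) *
        ∫ w in Ioi (α * √t), exp (-(w ^ 2) / 2) / √(2 * π))) := by
    intro t
    unfold psiElGamma
    ring
  simp only [e]
  have hsub := integral_sub ((h1.const_mul 2).add h0) (h2.const_mul 2)
  simp only [Pi.add_apply] at hsub
  rw [hsub, integral_add (h1.const_mul 2) h0, integral_const_mul, integral_const_mul, h1v, h2v, h0v]
  have hs : √η = θ / √2 := by
    rw [hθe, sqrt_mul (by norm_num)]
    field_simp
  have h22 : √2 ^ 2 = (2 : ℝ) := sq_sqrt (by norm_num)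
  have hs2 : √2 * lam ^ k / (√η * (θ + α) * (θ + lam) ^ k) =
      2 / (θ * (α + θ)) * (lam / (lam + θ)) ^ k := by
    rw [hs, div_pow, add_comm θ α, add_comm θ lam]
    have : 0 < α + θ := by positivity
    field_simp
    linarith
  rw [← hθe, hs2]
  have : 0 < α + θ := by positivity
  simp only [mul_zero, exp_zero]
  field_simp
  ring
end
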